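/- arXiv:math-ph/0608051 — 2 statements merged into one kernel-verified Lean document; each statement's English description precedes it below -/
import Mathlib

section
/- Fix m ≥ 2. For real (or complex) variables a_1, …, a_{m+1}, b_1, …, b_m, let L be the symmetric 2m×2m matrix with diagonal entries L_{2k−1,2k−1} = b_k and L_{2k,2k} = −b_k (1 ≤ k ≤ m), off-diagonal entries L_{1,2} = a_1, L_{2m−1,2m} = a_{m+1}, L_{2k−1,2k+1} = a_{k+1} and L_{2k,2k+2} = −a_{k+1} for 1 ≤ k ≤ m−1 (and their symmetric counterparts), all other entries zero; and let B be the skew-symmetric 2m×2m matrix with B_{1,2} = −a_1, B_{2m−1,2m} = a_{m+1}, B_{2k−1,2k+1} = a_{k+1} and B_{2k,2k+2} = a_{k+1} for 1 ≤ k ≤ m−1 (and B_{ji} = −B_{ij}), all other entries zero. Then a differentiable curve (a(t), b(t)) satisfies the system ȧ_1 = 2a_1b_1, ȧ_j = a_j(b_j − b_{j−1}) (2 ≤ j ≤ m), ȧ_{m+1} = −2a_{m+1}b_m, ḃ_j = 2(a_{j+1}² − a_j²) (1 ≤ j ≤ m) if and only if the matrix Lax equation dL/dt = B·L − L·B holds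 (entrywise). -/
/-- Strictly-upper-triangular entries (1-based `i < j`) of the symmetric Lax matrix `L`:
`L_{1,2} = a_1`, `L_{2m-1,2m} = a_{m+1}`, `L_{2k-1,2k+1} = a_{k+1}`,
`L_{2k,2k+2} = -a_{k+1}` for `1 ≤ k ≤ m-1`. -/
noncomputable def LentU (m : ℕ) (a : ℕ → ℝ) (i j : ℕ) : ℝ :=
  if i = 1 ∧ j = 2 then a 1
  else if i = 2*m - 1 ∧ j = 2*m then a (m+1)
  else if j = i + 2 ∧ i % 2 = 1 ∧ i ≤ 2*m - 3 then a ((i+1)/2 + 1)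
  else if j = i + 2 ∧ i % 2 = 0 ∧ 1 ≤ i ∧ i ≤ 2*m - 2 then -(a (i/2 + 1))
  else 0

/-- Entry (1-based) of the symmetric Lax matrix `L`: diagonal `L_{2k-1,2k-1} = b_k`,
`L_{2k,2k} = -b_k`; off-diagonal entries via `LentU` and symmetry. -/
noncomputable def Lent (m : ℕ) (a b : ℕ → ℝ) (i j : ℕ) : ℝ :=
  if i = j then (if i % 2 = 1 then b ((i+1)/2) else -(b (i/2)))
  else if i < j then LentU m a i j
  else LentU m a j i

/-- The symmetric `2m × 2m` Lax matrix `L`. -/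
noncomputable def LMat (m : ℕ) (a b : ℕ → ℝ) : Matrix (Fin (2*m)) (Fin (2*m)) ℝ :=
  fun i j => Lent m a b ((i : ℕ) + 1) ((j : ℕ) + 1)

/-- Strictly-upper-triangular entries (1-based `i < j`) of the skew matrix `B`:
`B_{1,2} = -a_1`, `B_{2m-1,2m} = a_{m+1}`, `B_{2k-1,2k+1} = a_{k+1}`,
`B_{2k,2k+2} = a_{k+1}` for `1 ≤ k ≤ m-1`. -/
noncomputable def BentU (m : ℕ) (a : ℕ → ℝ) (i j : ℕ) : ℝ :=
  if i = 1 ∧ j = 2 then -(a 1)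
  else if i = 2*m - 1 ∧ j = 2*m then a (m+1)
  else if j = i + 2 ∧ i % 2 = 1 ∧ i ≤ 2*m - 3 then a ((i+1)/2 + 1)
  else if j = i + 2 ∧ i % 2 = 0 ∧ 1 ≤ i ∧ i ≤ 2*m - 2 then a (i/2 + 1)
  else 0

/-- The skew-symmetric `2m × 2m` matrix `B` of the Lax pair. -/
noncomputable def BMat (m : ℕ) (a : ℕ → ℝ) : Matrix (Fin (2*m)) (Fin (2*m)) ℝ :=
  fun i j =>
    if (i : ℕ) < (j : ℕ) then BentU m a ((i : ℕ) + 1) ((j : ℕ) + 1)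
    else if (j : ℕ) < (i : ℕ) then -(BentU m a ((j : ℕ) + 1) ((i : ℕ) + 1))
    else 0


/-- Tridiagonal block. -/
noncomputable def auxT (a b : ℕ → ℝ) (p q : ℕ) : ℝ :=
  if p = q then b (p+1) else if q = p + 1 then a (q+1) else if p = q + 1 then a (p+1) else 0

noncomputable def auxK (a : ℕ → ℝ) (p q : ℕ) : ℝ :=
  if q = p + 1 then a (q+1) else if p = q + 1 then -a (p+1) else 0

noncomputable def auxE (m : ℕ) (a : ℕ → ℝ) (p : ℕ) : ℝ :=
  if p = 0 then a 1 else if p + 1 = m then a (m+1) else 0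

noncomputable def auxF (m : ℕ) (a : ℕ → ℝ) (p : ℕ) : ℝ :=
  if p = 0 then -a 1 else if p + 1 = m then a (m+1) else 0

noncomputable def auxB (m : ℕ) (a : ℕ → ℝ) (i j : ℕ) : ℝ :=
  if i < j then BentU m a (i + 1) (j + 1)
    else if j < i then -(BentU m a (j + 1) (i + 1))
    else 0

noncomputable def auxP (a b : ℕ → ℝ) (p q : ℕ) : ℝ :=
  if p = q then 2 * (a (p+2) ^ 2 - a (p+1) ^ 2)
  else if q = p + 1 then a (q+1) * (b (q+1) - b (p+1))
  else if p = q + 1 then a (p+1) * (b (p+1) - b (q+1)) else 0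

noncomputable def auxQ (m : ℕ) (a b : ℕ → ℝ) (p q : ℕ) : ℝ :=
  if p = q then (if p = 0 then 2 * a 1 * b 1 else if p + 1 = m then -2 * a (m+1) * b m else 0)
  else 0


theorem auxL_00 (m : ℕ) (hm : 2 ≤ m) (a b : ℕ → ℝ) (p q : ℕ) (hp : p < m) (hq : q < m) :
    Lent m a b (2*p+0+1) (2*q+0+1) = auxT a b p q := by
  unfold Lent LentU auxT
  grind (splits := 30)

theorem auxB_00 (m : ℕ) (hm : 2 ≤ m) (a : ℕ → ℝ) (p q : ℕ) (hp : p < m) (hq : q < m) :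
    auxB m a (2*p+0) (2*q+0) = auxK a p q := by
  unfold auxB BentU auxK
  grind (splits := 30)

theorem auxL_01 (m : ℕ) (hm : 2 ≤ m) (a b : ℕ → ℝ) (p q : ℕ) (hp : p < m) (hq : q < m) :
    Lent m a b (2*p+0+1) (2*q+1+1) = if p = q then auxE m a p else 0 := by
  unfold Lent LentU auxE
  grind (splits := 30)

theorem auxB_01 (m : ℕ) (hm : 2 ≤ m) (a : ℕ → ℝ) (p q : ℕ) (hp : p < m) (hq : q < m) :
    auxB m a (2*p+0) (2*q+1) = if p = q then auxF m a p else 0 := by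
  unfold auxB BentU auxF
  grind (splits := 30)

theorem auxL_10 (m : ℕ) (hm : 2 ≤ m) (a b : ℕ → ℝ) (p q : ℕ) (hp : p < m) (hq : q < m) :
    Lent m a b (2*p+1+1) (2*q+0+1) = if p = q then auxE m a p else 0 := by
  unfold Lent LentU auxE
  grind (splits := 30)

theorem auxB_10 (m : ℕ) (hm : 2 ≤ m) (a : ℕ → ℝ) (p q : ℕ) (hp : p < m) (hq : q < m) :
    auxB m a (2*p+1) (2*q+0) = if p = q then -auxF m a p else 0 := by
  unfold auxB BentU auxF
  grind (splits := 30)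

theorem auxL_11 (m : ℕ) (hm : 2 ≤ m) (a b : ℕ → ℝ) (p q : ℕ) (hp : p < m) (hq : q < m) :
    Lent m a b (2*p+1+1) (2*q+1+1) = -auxT a b p q := by
  unfold Lent LentU auxT
  grind (splits := 30)

theorem auxB_11 (m : ℕ) (hm : 2 ≤ m) (a : ℕ → ℝ) (p q : ℕ) (hp : p < m) (hq : q < m) :
    auxB m a (2*p+1) (2*q+1) = auxK a p q := by
  unfold auxB BentU auxK
  grind (splits := 30)

theorem aux_sum_two (m : ℕ) (f : ℕ → ℝ) :
    ∑ k ∈ Finset.range (2*m), f k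
      = ∑ k ∈ Finset.range m, (f (2*k+0) + f (2*k+1)) := by
  induction m with
  | zero => simp
  | succ n ih =>
    rw [Finset.sum_range_succ, ← ih, show 2 * (n+1) = 2*n+1+1 by ring,
      Finset.sum_range_succ, Finset.sum_range_succ]
    ring

theorem aux_sum_K (m : ℕ) (a X : ℕ → ℝ) (p : ℕ) (hp : p < m) :
    ∑ k ∈ Finset.range m, auxK a p k * X k
      = (if p + 1 < m then a (p+2) * X (p+1) else 0)
        - (if 1 ≤ p then a (p+1) * X (p-1) else 0) := by
  have h : ∀ k, auxK a p k * X k = (if k = p + 1 then a (p+2) * X (p+1) else 0)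
      - (if k = p - 1 then (if 1 ≤ p then a (p+1) * X (p-1) else 0) else 0) := by
    intro k
    unfold auxK
    grind (splits := 30)
  simp only [h, Finset.sum_sub_distrib, Finset.sum_ite_eq', Finset.mem_range]
  grind (splits := 30)

theorem auxK_swap (a : ℕ → ℝ) (p q : ℕ) : auxK a p q = - auxK a q p := by
  unfold auxK; grind (splits := 30)

theorem aux_KT (m : ℕ) (hm : 2 ≤ m) (a b : ℕ → ℝ) (p q : ℕ) (hp : p < m) (hq : q < m) :
    ∑ k ∈ Finset.range m, (auxK a p k * auxT a b k q - auxT a b p k * auxK a k q)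
      = auxP a b p q - (if p = q then 2 * auxF m a p * auxE m a p else 0) := by
  have h : ∀ k, auxK a p k * auxT a b k q - auxT a b p k * auxK a k q
      = auxK a p k * auxT a b k q + auxK a q k * auxT a b p k := by
    intro k; rw [auxK_swap a k q]; ring
  simp only [h, Finset.sum_add_distrib]
  rw [aux_sum_K m a (fun k => auxT a b k q) p hp, aux_sum_K m a (fun k => auxT a b p k) q hq]
  unfold auxT auxP auxE auxF
  grind (splits := 30)

theorem aux_Q (m : ℕ) (hm : 2 ≤ m) (a b : ℕ → ℝ) (p q : ℕ) (hp : p < m) (hq : q < m) :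
    auxK a p q * auxE m a q - auxE m a p * auxK a p q
      - (auxF m a p * auxT a b p q + auxT a b p q * auxF m a q) = auxQ m a b p q := by
  unfold auxT auxQ auxE auxF auxK
  grind (splits := 30)

/-- The commutator entry with natural number indices. -/
noncomputable def auxC (m : ℕ) (a b : ℕ → ℝ) (i j : ℕ) : ℝ :=
  ∑ k ∈ Finset.range (2*m), (auxB m a i k * Lent m a b (k+1) (j+1)
    - Lent m a b (i+1) (k+1) * auxB m a k j)

theorem auxC_00 (m : ℕ) (hm : 2 ≤ m) (a b : ℕ → ℝ) (p q : ℕ) (hp : p < m) (hq : q < m) :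
    auxC m a b (2*p+0) (2*q+0) = auxP a b p q := by
  have h : ∀ k ∈ Finset.range m,
      (auxB m a (2*p+0) (2*k+0) * Lent m a b (2*k+0+1) (2*q+0+1)
        - Lent m a b (2*p+0+1) (2*k+0+1) * auxB m a (2*k+0) (2*q+0)) +
      (auxB m a (2*p+0) (2*k+1) * Lent m a b (2*k+1+1) (2*q+0+1)
        - Lent m a b (2*p+0+1) (2*k+1+1) * auxB m a (2*k+1) (2*q+0)) = 
      (auxK a p k * auxT a b k q - auxT a b p k * auxK a k q)
        + (if k = p then (if p = q then (2 * auxF m a p * auxE m a p) else 0) else 0) := by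
    intro k hk
    have hk := Finset.mem_range.mp hk
    rw [auxB_00 m hm a p k hp hk, auxB_01 m hm a p k hp hk,
      auxB_00 m hm a k q hk hq, auxB_10 m hm a k q hk hq,
      auxL_00 m hm a b p k hp hk, auxL_01 m hm a b p k hp hk,
      auxL_00 m hm a b k q hk hq, auxL_10 m hm a b k q hk hq]
    split_ifs <;> grind (splits := 30)
  unfold auxC
  rw [aux_sum_two, Finset.sum_congr rfl h, Finset.sum_add_distrib, Finset.sum_ite_eq',
    aux_KT m hm a b p q hp hq]
  simp only [Finset.mem_range, hp, if_true]
  split_ifs <;> ring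

theorem auxC_01 (m : ℕ) (hm : 2 ≤ m) (a b : ℕ → ℝ) (p q : ℕ) (hp : p < m) (hq : q < m) :
    auxC m a b (2*p+0) (2*q+1) = auxQ m a b p q := by
  have h : ∀ k ∈ Finset.range m,
      (auxB m a (2*p+0) (2*k+0) * Lent m a b (2*k+0+1) (2*q+1+1)
        - Lent m a b (2*p+0+1) (2*k+0+1) * auxB m a (2*k+0) (2*q+1)) +
      (auxB m a (2*p+0) (2*k+1) * Lent m a b (2*k+1+1) (2*q+1+1)
        - Lent m a b (2*p+0+1) (2*k+1+1) * auxB m a (2*k+1) (2*q+1)) = 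
      (if k = q then auxK a p q * auxE m a q - auxT a b p q * auxF m a q else 0)
        - (if k = p then auxE m a p * auxK a p q + auxF m a p * auxT a b p q else 0) := by
    intro k hk
    have hk := Finset.mem_range.mp hk
    rw [auxB_00 m hm a p k hp hk, auxB_01 m hm a p k hp hk,
      auxB_01 m hm a k q hk hq, auxB_11 m hm a k q hk hq,
      auxL_00 m hm a b p k hp hk, auxL_01 m hm a b p k hp hk,
      auxL_01 m hm a b k q hk hq, auxL_11 m hm a b k q hk hq]
    split_ifs <;> grind (splits := 30)
  unfold auxC
  rw [aux_sum_two, Finset.sum_congr rfl h, Finset.sum_sub_distrib, Finset.sum_ite_eq',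
    Finset.sum_ite_eq', ← aux_Q m hm a b p q hp hq]
  simp only [Finset.mem_range, hp, hq, if_true]
  ring

theorem auxC_10 (m : ℕ) (hm : 2 ≤ m) (a b : ℕ → ℝ) (p q : ℕ) (hp : p < m) (hq : q < m) :
    auxC m a b (2*p+1) (2*q+0) = auxQ m a b p q := by
  have h : ∀ k ∈ Finset.range m,
      (auxB m a (2*p+1) (2*k+0) * Lent m a b (2*k+0+1) (2*q+0+1)
        - Lent m a b (2*p+1+1) (2*k+0+1) * auxB m a (2*k+0) (2*q+0)) +
      (auxB m a (2*p+1) (2*k+1) * Lent m a b (2*k+1+1) (2*q+0+1)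
        - Lent m a b (2*p+1+1) (2*k+1+1) * auxB m a (2*k+1) (2*q+0)) = 
      (if k = q then auxK a p q * auxE m a q - auxT a b p q * auxF m a q else 0)
        - (if k = p then auxE m a p * auxK a p q + auxF m a p * auxT a b p q else 0) := by
    intro k hk
    have hk := Finset.mem_range.mp hk
    rw [auxB_10 m hm a p k hp hk, auxB_11 m hm a p k hp hk,
      auxB_00 m hm a k q hk hq, auxB_10 m hm a k q hk hq,
      auxL_10 m hm a b p k hp hk, auxL_11 m hm a b p k hp hk,
      auxL_00 m hm a b k q hk hq, auxL_10 m hm a b k q hk hq]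
    split_ifs <;> grind (splits := 30)
  unfold auxC
  rw [aux_sum_two, Finset.sum_congr rfl h, Finset.sum_sub_distrib, Finset.sum_ite_eq',
    Finset.sum_ite_eq', ← aux_Q m hm a b p q hp hq]
  simp only [Finset.mem_range, hp, hq, if_true]
  ring

theorem auxC_11 (m : ℕ) (hm : 2 ≤ m) (a b : ℕ → ℝ) (p q : ℕ) (hp : p < m) (hq : q < m) :
    auxC m a b (2*p+1) (2*q+1) = -auxP a b p q := by
  have h : ∀ k ∈ Finset.range m,
      (auxB m a (2*p+1) (2*k+0) * Lent m a b (2*k+0+1) (2*q+1+1)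
        - Lent m a b (2*p+1+1) (2*k+0+1) * auxB m a (2*k+0) (2*q+1)) +
      (auxB m a (2*p+1) (2*k+1) * Lent m a b (2*k+1+1) (2*q+1+1)
        - Lent m a b (2*p+1+1) (2*k+1+1) * auxB m a (2*k+1) (2*q+1)) = 
      -(auxK a p k * auxT a b k q - auxT a b p k * auxK a k q)
        + (if k = p then (if p = q then -(2 * auxF m a p * auxE m a p) else 0) else 0) := by
    intro k hk
    have hk := Finset.mem_range.mp hk
    rw [auxB_10 m hm a p k hp hk, auxB_11 m hm a p k hp hk,
      auxB_01 m hm a k q hk hq, auxB_11 m hm a k q hk hq,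
      auxL_10 m hm a b p k hp hk, auxL_11 m hm a b p k hp hk,
      auxL_01 m hm a b k q hk hq, auxL_11 m hm a b k q hk hq]
    split_ifs <;> grind (splits := 30)
  unfold auxC
  rw [aux_sum_two, Finset.sum_congr rfl h, Finset.sum_add_distrib, Finset.sum_ite_eq',
    Finset.sum_neg_distrib, aux_KT m hm a b p q hp hq]
  simp only [Finset.mem_range, hp, if_true]
  split_ifs <;> ring

theorem auxC_eq (m : ℕ) (a b : ℕ → ℝ) (i j : Fin (2*m)) :
    (BMat m a * LMat m a b - LMat m a b * BMat m a) i j = auxC m a b i j := by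
  rw [Matrix.sub_apply, Matrix.mul_apply, Matrix.mul_apply, ← Finset.sum_sub_distrib]
  unfold auxC
  rw [Finset.sum_range]
  rfl

/-- a differentiable curve `(a(t), b(t))` satisfies the system
`ȧ_1 = 2a_1b_1`, `ȧ_j = a_j(b_j - b_{j-1})` (`2 ≤ j ≤ m`), `ȧ_{m+1} = -2a_{m+1}b_m`,
`ḃ_j = 2(a_{j+1}² - a_j²)` (`1 ≤ j ≤ m`) if and only if the Lax equation
`dL/dt = B·L - L·B` holds entrywise. -/
theorem ab_system_iff_lax (m : ℕ) (hm : 2 ≤ m) (a b : ℝ → ℕ → ℝ) :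
    ((∀ t, HasDerivAt (fun s => a s 1) (2 * a t 1 * b t 1) t ∧
        (∀ j, 2 ≤ j → j ≤ m →
          HasDerivAt (fun s => a s j) (a t j * (b t j - b t (j-1))) t) ∧
        HasDerivAt (fun s => a s (m+1)) (-2 * a t (m+1) * b t m) t ∧
        (∀ j, 1 ≤ j → j ≤ m →
          HasDerivAt (fun s => b s j) (2 * ((a t (j+1))^2 - (a t j)^2)) t))
      ↔ (∀ t, ∀ i j : Fin (2*m),
          HasDerivAt (fun s => LMat m (a s) (b s) i j)
            ((BMat m (a t) * LMat m (a t) (b t) - LMat m (a t) (b t) * BMat m (a t)) i j) t)) := by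
  have key : (∀ t, ∀ i j : Fin (2*m),
          HasDerivAt (fun s => LMat m (a s) (b s) i j)
            ((BMat m (a t) * LMat m (a t) (b t) - LMat m (a t) (b t) * BMat m (a t)) i j) t)
      ↔ ∀ t, ∀ p q : ℕ, p < m → q < m →
        (HasDerivAt (fun s => auxT (a s) (b s) p q) (auxP (a t) (b t) p q) t ∧
         HasDerivAt (fun s => if p = q then auxE m (a s) p else 0) (auxQ m (a t) (b t) p q) t) := by
    constructor
    · intro h t p q hp hq
      have h0 := h t ⟨2*p+0, by omega⟩ ⟨2*q+0, by omega⟩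
      have h1 := h t ⟨2*p+0, by omega⟩ ⟨2*q+1, by omega⟩
      rw [auxC_eq] at h0 h1
      simp only [LMat] at h0 h1
      simp only [auxC_00 m hm _ _ p q hp hq, auxL_00 m hm _ _ p q hp hq] at h0
      simp only [auxC_01 m hm _ _ p q hp hq, auxL_01 m hm _ _ p q hp hq] at h1
      exact ⟨h0, h1⟩
    · intro h t i j
      rw [auxC_eq]
      simp only [LMat]
      obtain ⟨i, hi⟩ := i
      obtain ⟨j, hj⟩ := j
      simp only
      obtain ⟨p, hp, hi'⟩ : ∃ p, p < m ∧ (i = 2*p+0 ∨ i = 2*p+1) :=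
        ⟨i/2, by omega, by omega⟩
      obtain ⟨q, hq, hj'⟩ : ∃ q, q < m ∧ (j = 2*q+0 ∨ j = 2*q+1) :=
        ⟨j/2, by omega, by omega⟩
      obtain ⟨h0, h1⟩ := h t p q hp hq
      rcases hi' with rfl | rfl <;> rcases hj' with rfl | rfl
      · simp only [auxC_00 m hm _ _ p q hp hq, auxL_00 m hm _ _ p q hp hq]
        exact h0
      · simp only [auxC_01 m hm _ _ p q hp hq, auxL_01 m hm _ _ p q hp hq]
        exact h1
      · simp only [auxC_10 m hm _ _ p q hp hq, auxL_10 m hm _ _ p q hp hq]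
        exact h1
      · simp only [auxC_11 m hm _ _ p q hp hq, auxL_11 m hm _ _ p q hp hq]
        exact h0.neg
  rw [key]
  refine forall_congr' fun t => ?_
  constructor
  · rintro ⟨h1, h2, h3, h4⟩ p q hp hq
    constructor
    · unfold auxT auxP
      split_ifs with c1 c2 c3
      · exact h4 (p+1) (by omega) (by omega)
      · subst c2
        exact h2 (p+1+1) (by omega) (by omega)
      · subst c3
        exact h2 (q+1+1) (by omega) (by omega)
      · exact hasDerivAt_const _ _
    · unfold auxE auxQ
      split_ifs
      · exact h1
      · exact h3
      · exact hasDerivAt_const _ _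
      · exact hasDerivAt_const _ _
  · intro h
    refine ⟨?_, ?_, ?_, ?_⟩
    · simpa [auxE, auxQ] using (h 0 0 (by omega) (by omega)).2
    · intro j hj hj'
      obtain ⟨k, rfl⟩ : ∃ k, j = k + 2 := ⟨j - 2, by omega⟩
      simpa [auxT, auxP] using (h k (k+1) (by omega) (by omega)).1
    · obtain ⟨k, rfl⟩ : ∃ k, m = k + 2 := ⟨m - 2, by omega⟩
      simpa [auxE, auxQ] using (h (k+1) (k+1) (by omega) (by omega)).2
    · intro j hj hj'
      obtain ⟨k, rfl⟩ : ∃ k, j = k + 1 := ⟨j - 1, by omega⟩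
      simpa [auxT, auxP] using (h k k (by omega) (by omega)).1
end

section
/- Fix m ≥ 2 and let (a(t), b(t)) be a differentiable solution of the system ȧ_1 = 2a_1b_1, ȧ_j = a_j(b_j − b_{j−1}) (2 ≤ j ≤ m), ȧ_{m+1} = −2a_{m+1}b_m, ḃ_j = 2(a_{j+1}² − a_j²) (1 ≤ j ≤ m). Let L(t) be the symmetric 2m×2m matrix with diagonal entries L_{2k−1,2k−1} = b_k, L_{2k,2k} = −b_k (1 ≤ k ≤ m), L_{1,2} = a_1, L_{2m−1,2m} = a_{m+1}, L_{2k−1,2k+1} = a_{k+1} and L_{2k,2k+2} = −a_{k+1} for 1 ≤ k ≤ m−1 (and symmetric counterparts), all other entries zero. Then for every positive integer k, the function t ↦ trace(L(t)^{2k}) is constant. -/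
/-- Cyclic successor in the cycle `y_m, …, y_1, x_1, …, x_m`. -/
def nxtE (m : ℕ) : Equiv.Perm (Fin (2*m)) where
  toFun i := ⟨if i.val % 2 = 0 then (if i.val + 2 < 2*m then i.val + 2 else i.val + 1)
    else (if i.val = 1 then 0 else i.val - 2), by have := i.isLt; split_ifs <;> omega⟩
  invFun i := ⟨if i.val % 2 = 0 then (if i.val = 0 then 1 else i.val - 2)
    else (if i.val + 2 < 2*m then i.val + 2 else i.val - 1), by have := i.isLt; split_ifs <;> omega⟩
  left_inv i := by
    have := i.isLt
    apply Fin.ext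
    dsimp only
    grind
  right_inv i := by
    have := i.isLt
    apply Fin.ext
    dsimp only
    grind

/-- Edge weight from `i` to its successor. -/
noncomputable def alphaE (a : ℕ → ℝ) (i : ℕ) : ℝ :=
  if i % 2 = 0 then a (i/2 + 2) else if i = 1 then a 1 else - a ((i+1)/2)

/-- Diagonal entry. -/
noncomputable def betaE (b : ℕ → ℝ) (i : ℕ) : ℝ :=
  if i % 2 = 0 then b (i/2 + 1) else - b ((i+1)/2)

set_option maxHeartbeats 4000000 in
theorem LMat_entry (m : ℕ) (hm : 2 ≤ m) (a b : ℕ → ℝ) (i j : Fin (2*m)) :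
    LMat m a b i j = (if i = j then betaE b i else 0) + (if nxtE m i = j then alphaE a i else 0)
      + (if nxtE m j = i then alphaE a j else 0) := by
  obtain ⟨i, hi⟩ := i
  obtain ⟨j, hj⟩ := j
  simp only [LMat, Lent, LentU, betaE, alphaE, nxtE, Equiv.coe_fn_mk, Fin.mk.injEq]
  have e1 : (i + 1 = j + 1) = (i = j) := by simp
  simp only [e1]
  by_cases hij : i = j
  · subst hij
    split_ifs <;> first | omega | (simp only [add_zero, neg_inj]; try (congr 1; omega))
  · simp only [hij, if_false, zero_add]
    rcases Nat.lt_or_gt_of_ne hij with h | h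
    · rw [if_pos (by omega : i + 1 < j + 1)]
      split_ifs <;> first | omega | (simp only [add_zero, zero_add, neg_inj]; try (congr 1; omega))
    · rw [if_neg (by omega : ¬ i + 1 < j + 1)]
      split_ifs <;> first | omega | (simp only [add_zero, zero_add, neg_inj]; try (congr 1; omega))

theorem pow_deriv {n : ℕ} (L : ℝ → Matrix (Fin n) (Fin n) ℝ) (B : Matrix (Fin n) (Fin n) ℝ) (t : ℝ)
    (h : ∀ i j, HasDerivAt (fun s => L s i j) ((B * L t - L t * B) i j) t) (k : ℕ) :
    ∀ i j, HasDerivAt (fun s => (L s ^ k) i j) ((B * L t ^ k - L t ^ k * B) i j) t := by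
  induction k with
  | zero =>
    intro i j
    simpa using hasDerivAt_const t ((1 : Matrix (Fin n) (Fin n) ℝ) i j)
  | succ k ih =>
    intro i j
    have e : B * L t ^ (k+1) - L t ^ (k+1) * B
        = (B * L t ^ k - L t ^ k * B) * L t + L t ^ k * (B * L t - L t * B) := by
      rw [pow_succ]; noncomm_ring
    rw [e]
    have e2 : (fun s => (L s ^ (k+1)) i j) = fun s => ∑ l, (L s ^ k) i l * L s l j := by
      ext s
      rw [pow_succ, Matrix.mul_apply]
    rw [e2, Matrix.add_apply, Matrix.mul_apply, Matrix.mul_apply (M := L t ^ k),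
      ← Finset.sum_add_distrib]
    exact HasDerivAt.fun_sum fun l _ => (ih i l).fun_mul (h l j)

theorem toda_lax {n : ℕ} (σ : Equiv.Perm (Fin n)) (α β : Fin n → ℝ) :
    ∃ B : Matrix (Fin n) (Fin n) ℝ, ∀ L : Matrix (Fin n) (Fin n) ℝ,
      (∀ i j, L i j = (if i = j then β i else 0) + (if σ i = j then α i else 0)
        + (if σ j = i then α j else 0)) → ∀ i j,
      (B * L - L * B) i j = (if i = j then 2 * (α i ^ 2 - α (σ.symm i) ^ 2) else 0)
        + (if σ i = j then α i * (β (σ i) - β i) else 0)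
        + (if σ j = i then α j * (β (σ j) - β j) else 0) := by
  let X : Matrix (Fin n) (Fin n) ℝ := Matrix.of fun i j => if σ i = j then α i else 0
  let Y : Matrix (Fin n) (Fin n) ℝ := Matrix.of fun i j => if σ j = i then α j else 0
  refine ⟨X - Y, fun L hL i j => ?_⟩
  have eL : L = Matrix.diagonal β + X + Y := by
    ext i j
    simp [hL, X, Y, Matrix.diagonal_apply]
  have e : (X - Y) * L - L * (X - Y) = (X * Matrix.diagonal β - Matrix.diagonal β * X)
      - (Y * Matrix.diagonal β - Matrix.diagonal β * Y) + (2:ℝ) • (X * Y - Y * X) := by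
    rw [eL, two_smul]; noncomm_ring
  have hXY : (X * Y) i j = if i = j then α i ^ 2 else 0 := by
    simp only [X, Y, Matrix.mul_apply, Matrix.of_apply]
    rw [Finset.sum_eq_single (σ i)]
    · by_cases h : i = j
      · subst h; simp [sq]
      · have : ¬ j = i := fun hq => h hq.symm
        simp [h, this]
    · intro c _ hc
      simp [hc.symm]
    · simp
  have hYX : (Y * X) i j = if i = j then α (σ.symm i) ^ 2 else 0 := by
    simp only [X, Y, Matrix.mul_apply, Matrix.of_apply]
    rw [Finset.sum_eq_single (σ.symm i)]
    · by_cases h : i = j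
      · subst h; simp [sq]
      · simp [h]
    · intro c _ hc
      have : ¬ σ c = i := fun h => hc (by simp [← h])
      simp [this]
    · simp
  rw [e]
  simp only [Matrix.add_apply, Matrix.sub_apply, Matrix.smul_apply, hXY, hYX,
    Matrix.mul_diagonal, Matrix.diagonal_mul, X, Y, Matrix.of_apply, smul_eq_mul]
  have h1 : (if σ i = j then α i * (β (σ i) - β i) else 0)
      = (if σ i = j then α i else 0) * β j - β i * (if σ i = j then α i else 0) := by
    split_ifs with h
    · rw [h]; ring
    · ring
  have h2 : (if σ j = i then α j * (β (σ j) - β j) else 0)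
      = β i * (if σ j = i then α j else 0) - (if σ j = i then α j else 0) * β j := by
    split_ifs with h
    · rw [h]; ring
    · ring
  rw [h1, h2]
  split_ifs <;> ring

/-- along any differentiable solution of the system
`ȧ_1 = 2a_1b_1`, `ȧ_j = a_j(b_j - b_{j-1})` (`2 ≤ j ≤ m`), `ȧ_{m+1} = -2a_{m+1}b_m`,
`ḃ_j = 2(a_{j+1}² - a_j²)` (`1 ≤ j ≤ m`), the functions `t ↦ trace(L(t)^{2k})` are constant. -/
theorem trace_L_pow_constant (m : ℕ) (hm : 2 ≤ m) (a b : ℝ → ℕ → ℝ)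
    (hsys : ∀ t, HasDerivAt (fun s => a s 1) (2 * a t 1 * b t 1) t ∧
      (∀ j, 2 ≤ j → j ≤ m →
        HasDerivAt (fun s => a s j) (a t j * (b t j - b t (j-1))) t) ∧
      HasDerivAt (fun s => a s (m+1)) (-2 * a t (m+1) * b t m) t ∧
      (∀ j, 1 ≤ j → j ≤ m →
        HasDerivAt (fun s => b s j) (2 * ((a t (j+1))^2 - (a t j)^2)) t)) :
    ∀ k : ℕ, 1 ≤ k → ∀ t t' : ℝ,
      Matrix.trace ((LMat m (a t) (b t)) ^ (2*k))
        = Matrix.trace ((LMat m (a t') (b t')) ^ (2*k)) := by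
  have hβ : ∀ t (i : Fin (2*m)), HasDerivAt (fun s => betaE (b s) i)
      (2 * (alphaE (a t) i ^ 2 - alphaE (a t) ((nxtE m).symm i) ^ 2)) t := by
    intro t i
    obtain ⟨i, hi⟩ := i
    obtain ⟨-, -, -, h⟩ := hsys t
    rcases Nat.even_or_odd' i with ⟨c, rfl | rfl⟩
    · have hc := h (c+1) (by omega) (by omega)
      have e1 : 2 * c % 2 = 0 := by omega
      have e2 : 2 * c / 2 = c := by omega
      simp only [betaE, e1, e2, if_true]
      refine hc.congr_deriv ?_
      rcases Nat.eq_zero_or_pos c with rfl | hp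
      · simp [nxtE, alphaE]
      · obtain ⟨d, rfl⟩ : ∃ d, c = d + 1 := ⟨c - 1, by omega⟩
        have e3 : 2 * (d + 1) - 2 = 2 * d := by omega
        simp [nxtE, alphaE, e3]
    · have hc := (h (c+1) (by omega) (by omega)).fun_neg
      have e1 : ¬ (2 * c + 1) % 2 = 0 := by omega
      have e2 : (2 * c + 1 + 1) / 2 = c + 1 := by omega
      simp only [betaE, e1, e2, if_false]
      refine hc.congr_deriv ?_
      have e4 : alphaE (a t) (2 * c + 1) ^ 2 = a t (c+1) ^ 2 := by
        simp only [alphaE, e1, e2, if_false]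
        split_ifs with h0
        · have : c = 0 := by omega
          subst this; simp
        · ring
      have e5 : alphaE (a t) ((nxtE m).symm ⟨2 * c + 1, hi⟩) ^ 2 = a t (c+1+1) ^ 2 := by
        simp only [nxtE, Equiv.coe_fn_symm_mk, e1, if_false]
        split_ifs with h0
        · have e6 : ¬ (2 * c + 1 + 2) % 2 = 0 := by omega
          have e7 : (2 * c + 1 + 2 + 1) / 2 = c + 1 + 1 := by omega
          have e8 : ¬ (2 * c + 1 + 2 = 1) := by omega
          simp only [alphaE, e6, e7, e8, if_false]; ring
        · simp [alphaE]
      simp only [e4, e5]; ring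
  have hα : ∀ t (i : Fin (2*m)), HasDerivAt (fun s => alphaE (a s) i)
      (alphaE (a t) i * (betaE (b t) (nxtE m i) - betaE (b t) i)) t := by
    intro t i
    obtain ⟨i, hi⟩ := i
    obtain ⟨h1, h2, h3, -⟩ := hsys t
    rcases Nat.even_or_odd' i with ⟨c, rfl | rfl⟩
    · have e1 : 2 * c % 2 = 0 := by omega
      have e2 : 2 * c / 2 = c := by omega
      simp only [alphaE, betaE, nxtE, Equiv.coe_fn_mk, e1, e2, if_true]
      by_cases h0 : 2 * c + 2 < 2 * m
      · have e3 : (2 * c + 2) % 2 = 0 := by omega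
        have e4 : (2 * c + 2) / 2 = c + 1 := by omega
        simp only [h0, e3, e4, if_true]
        exact h2 (c+2) (by omega) (by omega)
      · have e3 : ¬ (2 * c + 1) % 2 = 0 := by omega
        have e4 : (2 * c + 1 + 1) / 2 = c + 1 := by omega
        simp only [h0, e3, e4, if_false]
        obtain rfl : m = c + 1 := by omega
        refine h3.congr_deriv ?_
        ring
    · have e1 : ¬ (2 * c + 1) % 2 = 0 := by omega
      have e2 : (2 * c + 1 + 1) / 2 = c + 1 := by omega
      simp only [alphaE, betaE, nxtE, Equiv.coe_fn_mk, e1, e2, if_false]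
      rcases Nat.eq_zero_or_pos c with rfl | hp
      · simp only [mul_zero, zero_add, if_true, Nat.zero_mod, Nat.zero_div]
        refine h1.congr_deriv ?_
        ring
      · obtain ⟨d, rfl⟩ : ∃ d, c = d + 1 := ⟨c - 1, by omega⟩
        have e3 : ¬ (2 * (d + 1) + 1 = 1) := by omega
        have e4 : 2 * (d + 1) + 1 - 2 = 2 * d + 1 := by omega
        have e5 : ¬ (2 * d + 1) % 2 = 0 := by omega
        have e6 : (2 * d + 1 + 1) / 2 = d + 1 := by omega
        simp only [e3, e4, e5, e6, if_false]
        refine (h2 (d+1+1) (by omega) (by omega)).fun_neg.congr_deriv ?_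
        simp only [Nat.add_sub_cancel]
        ring
  intro k _ t t'
  refine is_const_of_deriv_eq_zero
    (f := fun s => Matrix.trace ((LMat m (a s) (b s)) ^ (2*k))) ?_ ?_ t t'
  all_goals
    have key : ∀ t, HasDerivAt (fun s => Matrix.trace ((LMat m (a s) (b s)) ^ (2*k))) 0 t := by
      intro t
      obtain ⟨B, hB⟩ := toda_lax (nxtE m) (fun i => alphaE (a t) i) (fun i => betaE (b t) i)
      have hL := pow_deriv (fun s => LMat m (a s) (b s)) B t (by
        intro i j
        rw [hB _ (LMat_entry m hm (a t) (b t)) i j]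
        simp only [LMat_entry m hm]
        refine HasDerivAt.fun_add (HasDerivAt.fun_add ?_ ?_) ?_
        · split_ifs
          · exact hβ t i
          · exact hasDerivAt_const _ _
        · split_ifs
          · exact hα t i
          · exact hasDerivAt_const _ _
        · split_ifs
          · exact hα t j
          · exact hasDerivAt_const _ _) (2*k)
      have hs := HasDerivAt.fun_sum (u := Finset.univ) fun i _ => hL i i
      have e0 : ∑ i, (B * LMat m (a t) (b t) ^ (2*k) - LMat m (a t) (b t) ^ (2*k) * B) i i = 0 := by
        change Matrix.trace (B * LMat m (a t) (b t) ^ (2*k) - LMat m (a t) (b t) ^ (2*k) * B) = 0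
        rw [Matrix.trace_sub, Matrix.trace_mul_comm, sub_self]
      rw [e0] at hs
      exact hs
  · exact fun t => (key t).differentiableAt
  · exact fun t => (key t).deriv
end
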